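/- (Bochner's theorem, existence direction.) Let k : ℝ^d → ℂ be continuous and positive definite, meaning that for every n, every x₁, …, xₙ ∈ ℝ^d and every c₁, …, cₙ ∈ ℂ one has ∑_{i,j=1}^n c_i \overline{c_j} k(x_i − x_j) ∈ ℝ and is ≥ 0. Then there exists a finite positive Borel measure μ on ℝ^d such that k(x) = ∫_{ℝ^d} exp(i ⟨ω, x⟩) dμ(ω) for all x ∈ ℝ^d, and in particular k(0) = μ(ℝ^d). -/

import Mathlib

open MeasureTheory Complex
open scoped RealInnerProductSpace BigOperators

namespace Bochner

open Filter Topology FourierTransform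
open scoped ComplexOrder ComplexConjugate

/-- If all the sums `∑ i, ∑ j, g (x i, x j)` are nonnegative, then so is the integral of `g`
against the product of a probability measure with itself: average these sums over independent
samples and let their number tend to infinity. -/
lemma integral_prod_self_nonneg {X : Type*} [MeasurableSpace X] {ν : Measure X}
    [IsProbabilityMeasure ν] {g : X × X → ℂ} (hg : StronglyMeasurable g) {C : ℝ}
    (hC : ∀ p, ‖g p‖ ≤ C)
    (hpos : ∀ (n : ℕ) (x : Fin n → X), 0 ≤ ∑ i, ∑ j, g (x i, x j)) :
    0 ≤ ∫ p, g p ∂(ν.prod ν) := by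
  set A := ∫ p, g p ∂(ν.prod ν) with hA
  set B := ∫ x, g (x, x) ∂ν with hB
  have key (n : ℕ) : 0 ≤ A + ((n + 1 : ℕ) : ℂ)⁻¹ * (B - A) := by
    let P := Measure.pi (fun _ : Fin (n + 1) ↦ ν)
    have hmeas (i j : Fin (n + 1)) : Measurable fun x : Fin (n + 1) → X ↦ (x i, x j) := by fun_prop
    have hint (i j : Fin (n + 1)) : Integrable (fun x : Fin (n + 1) → X ↦ g (x i, x j)) P :=
      .of_bound (hg.comp_measurable (hmeas i j)).aestronglyMeasurable C (ae_of_all _ fun _ ↦ hC _)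
    have hval (i j : Fin (n + 1)) :
        ∫ x, g (x i, x j) ∂P = A + if i = j then B - A else 0 := by
      split_ifs with hij
      · subst hij
        have hmap : P.map (Function.eval i) = ν := (measurePreserving_eval (fun _ ↦ ν) i).map_eq
        have hdiag : StronglyMeasurable fun x ↦ g (x, x) := hg.comp_measurable (by fun_prop)
        rw [add_sub_cancel, hB, ← hmap,
          integral_map (measurable_pi_apply i).aemeasurable hdiag.aestronglyMeasurable]
      · have hind : ProbabilityTheory.IndepFun (fun x : Fin (n + 1) → X ↦ x i) (fun x ↦ x j) P :=
          (ProbabilityTheory.iIndepFun_pi (μ := fun _ : Fin (n + 1) ↦ ν) (X := fun _ ↦ id)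
            (fun _ ↦ aemeasurable_id)).indepFun hij
        have hmap (i : Fin (n + 1)) : P.map (fun x ↦ x i) = ν :=
          (measurePreserving_eval (fun _ ↦ ν) i).map_eq
        rw [ProbabilityTheory.indepFun_iff_map_prod_eq_prod_map_map
          (measurable_pi_apply i).aemeasurable (measurable_pi_apply j).aemeasurable,
          hmap, hmap] at hind
        rw [add_zero, hA, ← hind, integral_map (hmeas i j).aemeasurable hg.aestronglyMeasurable]
    have h0 : 0 ≤ ∫ x, ∑ i, ∑ j, g (x i, x j) ∂P := integral_nonneg fun x ↦ hpos _ x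
    rw [integral_finsetSum _ fun i _ ↦ integrable_finsetSum _ fun j _ ↦ hint i j] at h0
    simp_rw [integral_finsetSum _ fun j _ ↦ hint _ j, hval, Finset.sum_add_distrib] at h0
    simp only [Finset.sum_const, Finset.card_univ, Fintype.card_fin, Finset.sum_ite_eq,
      Finset.mem_univ, if_true, nsmul_eq_mul] at h0
    have hn : 0 ≤ ((n + 1 : ℕ) : ℂ)⁻¹ * ((n + 1 : ℕ) : ℂ)⁻¹ := by positivity
    have hn0 : ((n + 1 : ℕ) : ℂ) ≠ 0 := Nat.cast_ne_zero.2 n.succ_ne_zero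
    convert mul_nonneg hn h0 using 1
    field_simp
  have hlim : Tendsto (fun n : ℕ ↦ A + ((n + 1 : ℕ) : ℂ)⁻¹ * (B - A)) atTop
      (𝓝 (A + 0 * (B - A))) :=
    tendsto_const_nhds.add (((tendsto_inv_atTop_nhds_zero_nat (𝕜 := ℂ)).comp
      (tendsto_add_atTop_nat 1)).mul_const _)
  rw [zero_mul, add_zero] at hlim
  exact ge_of_tendsto' hlim key

section PositiveDefinite

variable {V : Type*} [AddGroup V]

/-- A function `k` on an additive group is positive definite if all the matrices
`(k (x i - x j))` are positive semidefinite. -/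
def PosDefFun (k : V → ℂ) : Prop :=
  ∀ (n : ℕ) (x : Fin n → V) (c : Fin n → ℂ),
    0 ≤ ∑ i, ∑ j, c i * conj (c j) * k (x i - x j)

lemma PosDefFun.zero_nonneg {k : V → ℂ} (hk : PosDefFun k) : 0 ≤ k 0 := by
  simpa using hk 1 (fun _ ↦ 0) (fun _ ↦ 1)

lemma PosDefFun.pair_nonneg {k : V → ℂ} (hk : PosDefFun k) (x : V) (a b : ℂ) :
    0 ≤ a * conj a * k 0 + a * conj b * k x + (b * conj a * k (-x) + b * conj b * k 0) := by
  simpa [Fin.sum_univ_two] using hk 2 ![x, 0] ![a, b]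

lemma PosDefFun.map_neg {k : V → ℂ} (hk : PosDefFun k) (x : V) : k (-x) = conj (k x) := by
  have h0 := (Complex.nonneg_iff.1 hk.zero_nonneg).2
  have h1 := (Complex.nonneg_iff.1 (hk.pair_nonneg x 1 1)).2
  have h2 := (Complex.nonneg_iff.1 (hk.pair_nonneg x I 1)).2
  simp at h1 h2
  apply Complex.ext
  · simp
    linarith
  · simp
    linarith

lemma PosDefFun.norm_le {k : V → ℂ} (hk : PosDefFun k) (x : V) : ‖k x‖ ≤ (k 0).re := by
  have h0 := (Complex.nonneg_iff.1 hk.zero_nonneg).1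
  rcases (norm_nonneg (k x)).eq_or_lt with h | h
  · rwa [← h]
  have h1 := hk.pair_nonneg x (-conj (k x)) ‖k x‖
  have h2 : -conj (k x) * conj (-conj (k x)) * k 0 + -conj (k x) * conj (‖k x‖ : ℂ) * k x +
      (‖k x‖ * conj (-conj (k x)) * k (-x) + ‖k x‖ * conj (‖k x‖ : ℂ) * k 0) =
      ((2 * ‖k x‖ ^ 2 : ℝ) : ℂ) * (k 0 - ‖k x‖) := by
    have := Complex.mul_conj' (k x)
    simp only [hk.map_neg, _root_.map_neg, Complex.conj_conj, Complex.conj_ofReal]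
    push_cast
    linear_combination (k 0 - 2 * ‖k x‖) * this
  rw [h2] at h1
  have h3 := (Complex.nonneg_iff.1 h1).1
  rw [Complex.re_ofReal_mul, Complex.sub_re, Complex.ofReal_re] at h3
  have := nonneg_of_mul_nonneg_right h3 (by positivity)
  linarith

end PositiveDefinite

section InnerProductSpace

variable {V : Type*} [NormedAddCommGroup V] [InnerProductSpace ℝ V] [FiniteDimensional ℝ V]
  [MeasurableSpace V] [BorelSpace V]

lemma integrable_rexp_neg_mul_sq_norm {b : ℝ} (hb : 0 < b) :
    Integrable fun v : V ↦ Real.exp (-b * ‖v‖ ^ 2) := by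
  have := (GaussianFourier.integrable_cexp_neg_mul_sq_norm_add (b := b) (by simpa) 0 (0 : V)).norm
  refine this.congr (ae_of_all _ fun v ↦ ?_)
  simp [Complex.norm_exp, ← Complex.ofReal_pow]

lemma integral_rexp_neg_mul_sq_norm_pos {b : ℝ} (hb : 0 < b) :
    0 < ∫ v : V, Real.exp (-b * ‖v‖ ^ 2) := by
  rw [GaussianFourier.integral_rexp_neg_mul_sq_norm hb]
  positivity

/-- The autocorrelation of a Gaussian is a Gaussian. -/
lemma integral_rexp_mul_rexp_sub {b : ℝ} (u : V) :
    ∫ x : V, Real.exp (-(2 * b) * ‖x‖ ^ 2) * Real.exp (-(2 * b) * ‖x - u‖ ^ 2) =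
      (∫ x : V, Real.exp (-(4 * b) * ‖x‖ ^ 2)) * Real.exp (-b * ‖u‖ ^ 2) := by
  rw [← integral_sub_right_eq_self (fun x ↦ Real.exp (-(4 * b) * ‖x‖ ^ 2)) ((2⁻¹ : ℝ) • u),
    ← integral_mul_const]
  congr 1 with x
  rw [← Real.exp_add, ← Real.exp_add, norm_sub_sq_real, norm_sub_sq_real, inner_smul_right,
    norm_smul, Real.norm_of_nonneg (by norm_num)]
  ring_nf

/-- Double integrals of a bounded function of `x - y` against Gaussian weights. -/
lemma integral_integral_gaussian_sub {G : V → ℂ} (hG : Continuous G) {M : ℝ}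
    (hM : ∀ x, ‖G x‖ ≤ M) {b : ℝ} (hb : 0 < b) :
    ∫ x : V, Real.exp (-(2 * b) * ‖x‖ ^ 2) • ∫ y : V, Real.exp (-(2 * b) * ‖y‖ ^ 2) • G (x - y) =
      (∫ x : V, Real.exp (-(4 * b) * ‖x‖ ^ 2)) • ∫ u : V, Real.exp (-b * ‖u‖ ^ 2) • G u := by
  have hint : Integrable (Function.uncurry fun x u : V ↦
      (Real.exp (-(2 * b) * ‖x‖ ^ 2) * Real.exp (-(2 * b) * ‖x - u‖ ^ 2)) • G u)
      (volume.prod volume) := by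
    have hc : 0 < 2 * b / 3 := by positivity
    refine (((integrable_rexp_neg_mul_sq_norm (V := V) hc).mul_prod
      (integrable_rexp_neg_mul_sq_norm (V := V) hc)).const_mul M).mono'
      (Continuous.aestronglyMeasurable (by unfold Function.uncurry; fun_prop)) (ae_of_all _ ?_)
    rintro ⟨x, u⟩
    simp only [Function.uncurry, norm_smul, ← Real.exp_add, Real.norm_eq_abs, Real.abs_exp]
    rw [mul_comm M]
    gcongr ?_ * ?_
    · refine Real.exp_le_exp.2 ?_
      have h1 : ‖u‖ ≤ ‖x‖ + ‖x - u‖ := by simpa using norm_sub_le x (x - u)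
      have h2 : ‖u‖ ^ 2 ≤ 2 * ‖x‖ ^ 2 + 2 * ‖x - u‖ ^ 2 := by
        nlinarith [sq_nonneg (‖x‖ - ‖x - u‖), norm_nonneg u]
      nlinarith [sq_nonneg ‖x - u‖, mul_le_mul_of_nonneg_left h2 hb.le,
        mul_nonneg hb.le (sq_nonneg ‖x - u‖)]
    · exact hM u
  calc
    _ = ∫ x : V, ∫ u : V,
        (Real.exp (-(2 * b) * ‖x‖ ^ 2) * Real.exp (-(2 * b) * ‖x - u‖ ^ 2)) • G u := by
      congr 1 with x
      rw [← integral_smul, ← integral_sub_left_eq_self _ _ x]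
      simp [mul_smul]
    _ = ∫ u : V, ∫ x : V,
        (Real.exp (-(2 * b) * ‖x‖ ^ 2) * Real.exp (-(2 * b) * ‖x - u‖ ^ 2)) • G u :=
      integral_integral_swap hint
    _ = _ := by
      simp_rw [integral_smul_const, integral_rexp_mul_rexp_sub, mul_smul]
      rw [integral_smul]

/-- The Fourier transform of a continuous positive definite function times a Gaussian is
nonnegative. -/
lemma PosDefFun.fourier_gaussian_smul_nonneg {k : V → ℂ} (hk : PosDefFun k) (hcont : Continuous k)
    {b : ℝ} (hb : 0 < b) (w : V) :
    0 ≤ 𝓕 (fun v ↦ Real.exp (-b * ‖v‖ ^ 2) • k v) w := by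
  let χ : V → ℂ := fun v ↦ cexp (↑(-2 * Real.pi * ⟪v, w⟫) * I)
  have hχ_norm v : ‖χ v‖ = 1 := Complex.norm_exp_ofReal_mul_I _
  have hχ_sub x y : χ (x - y) = χ x * conj (χ y) := by
    simp only [χ, ← Complex.exp_conj, ← Complex.exp_add, inner_sub_left, map_mul,
      Complex.conj_ofReal, Complex.conj_I]
    push_cast
    ring_nf
  let G : V → ℂ := fun v ↦ χ v * k v
  have hG : Continuous G := by fun_prop
  have hM v : ‖G v‖ ≤ (k 0).re := by simpa [G, hχ_norm] using hk.norm_le v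
  set C := ∫ v : V, Real.exp (-(2 * b) * ‖v‖ ^ 2) with hC
  have hC_pos : 0 < C := integral_rexp_neg_mul_sq_norm_pos (by positivity)
  let ν : Measure V :=
    volume.withDensity fun v ↦ ENNReal.ofReal (C⁻¹ * Real.exp (-(2 * b) * ‖v‖ ^ 2))
  have hν_int (F : V → ℂ) :
      ∫ v, F v ∂ν = C⁻¹ • ∫ v : V, Real.exp (-(2 * b) * ‖v‖ ^ 2) • F v := by
    rw [integral_withDensity_eq_integral_toReal_smul (by fun_prop) (by simp), ← integral_smul]
    congr 1 with v
    rw [ENNReal.toReal_ofReal (by positivity), mul_smul]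
  have : IsProbabilityMeasure ν := by
    refine ⟨?_⟩
    rw [withDensity_apply _ .univ, Measure.restrict_univ, ← ofReal_integral_eq_lintegral_ofReal
      ((integrable_rexp_neg_mul_sq_norm (by positivity)).const_mul _)
      (ae_of_all _ fun v ↦ by positivity), integral_const_mul, ← hC, inv_mul_cancel₀ hC_pos.ne',
      ENNReal.ofReal_one]
  have hpos : 0 ≤ ∫ p : V × V, G (p.1 - p.2) ∂(ν.prod ν) := by
    refine integral_prod_self_nonneg (g := fun p ↦ G (p.1 - p.2))
      (Continuous.stronglyMeasurable (by fun_prop)) (fun p ↦ hM _) fun n x ↦ ?_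
    simpa [G, hχ_sub] using hk n x (fun i ↦ χ (x i))
  rw [integral_prod _ (.of_bound (Continuous.aestronglyMeasurable (by fun_prop)) (k 0).re
    (ae_of_all _ fun p ↦ hM _))] at hpos
  simp_rw [hν_int, smul_comm _ C⁻¹] at hpos
  rw [integral_smul, integral_integral_gaussian_sub hG hM hb, smul_smul, smul_smul,
    Complex.real_smul] at hpos
  have hD : 0 < ∫ v : V, Real.exp (-(4 * b) * ‖v‖ ^ 2) :=
    integral_rexp_neg_mul_sq_norm_pos (by positivity)
  rw [Real.fourier_eq']
  have hinv := mul_nonneg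
    (Complex.zero_le_real.2
      (inv_pos.2 (mul_pos (mul_pos (inv_pos.2 hC_pos) (inv_pos.2 hC_pos)) hD)).le) hpos
  rw [← mul_assoc, ← Complex.ofReal_mul, inv_mul_cancel₀ (by positivity), Complex.ofReal_one,
    one_mul] at hinv
  simpa only [G, χ, smul_eq_mul, Complex.real_smul, mul_left_comm] using hinv

/-- A continuous function with nonnegative Fourier transform has an integrable Fourier
transform. -/
lemma integrable_fourier_of_nonneg {f : V → ℂ} (hint : Integrable f)
    {M : ℝ} (hM : ∀ v, ‖f v‖ ≤ M) (hpos : ∀ w, 0 ≤ 𝓕 f w) : Integrable (𝓕 f) := by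
  have hcont : Continuous (𝓕 f) :=
    VectorFourier.fourierIntegral_continuous (L := innerₗ V) Real.continuous_fourierChar
      continuous_inner hint
  have key {b : ℝ} (hb : 0 < b) :
      ∫⁻ w, ‖Real.exp (-b * ‖w‖ ^ 2) • 𝓕 f w‖ₑ ≤ ENNReal.ofReal M := by
    have hgint : Integrable fun v : V ↦ cexp (-b * ‖v‖ ^ 2) := by
      simpa using (integrable_rexp_neg_mul_sq_norm (V := V) hb).ofReal (𝕜 := ℂ)
    have hflip : ∫ w, 𝓕 f w * cexp (-b * ‖w‖ ^ 2) =
        ∫ v, f v * 𝓕 (fun v : V ↦ cexp (-b * ‖v‖ ^ 2)) v := by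
      have := VectorFourier.integral_fourierIntegral_smul_eq_flip (L := innerₗ V)
        Real.continuous_fourierChar continuous_inner hint hgint
      rwa [flip_innerₗ] at this
    have hgnorm (v : V) : ‖𝓕 (fun v : V ↦ cexp (-b * ‖v‖ ^ 2)) v‖ =
        (Real.pi / b) ^ (Module.finrank ℝ V / 2 : ℝ) *
          Real.exp (-(Real.pi ^ 2 / b) * ‖v‖ ^ 2) := by
      rw [fourier_gaussian_innerProductSpace (by simpa using hb), norm_mul, Complex.norm_exp,
        ← Complex.ofReal_div, Complex.norm_cpow_eq_rpow_re_of_pos (by positivity)]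
      congr 2
      · rw [← Complex.ofReal_natCast, ← Complex.ofReal_ofNat, ← Complex.ofReal_div,
          Complex.ofReal_re]
      · norm_cast
        ring
    have hb' : 0 < Real.pi ^ 2 / b := by positivity
    have hsmul (w : V) : ‖Real.exp (-b * ‖w‖ ^ 2) • 𝓕 f w‖ =
        (𝓕 f w * cexp (-b * ‖w‖ ^ 2)).re := by
      have : cexp (-b * ‖w‖ ^ 2) = (Real.exp (-b * ‖w‖ ^ 2) : ℝ) := by push_cast; rfl
      rw [norm_smul, this, Complex.re_mul_ofReal,
        ← Complex.re_eq_norm.2 (hpos w), Real.norm_eq_abs, Real.abs_exp, mul_comm]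
    have hprod : Integrable fun w ↦ 𝓕 f w * cexp (-b * ‖w‖ ^ 2) :=
      hgint.bdd_mul (c := ∫ v, ‖f v‖) hcont.aestronglyMeasurable (ae_of_all _ fun w ↦
        VectorFourier.norm_fourierIntegral_le_integral_norm _ _ _ _ _)
    rw [← ofReal_integral_norm_eq_lintegral_enorm]
    · refine ENNReal.ofReal_le_ofReal ?_
      simp_rw [hsmul]
      calc ∫ w, (𝓕 f w * cexp (-b * ‖w‖ ^ 2)).re
        _ = (∫ w, 𝓕 f w * cexp (-b * ‖w‖ ^ 2)).re := integral_re hprod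
        _ ≤ ‖∫ v, f v * 𝓕 (fun v : V ↦ cexp (-b * ‖v‖ ^ 2)) v‖ := by
          rw [hflip]; exact Complex.re_le_norm _
        _ ≤ ∫ v : V, M * ((Real.pi / b) ^ (Module.finrank ℝ V / 2 : ℝ) *
            Real.exp (-(Real.pi ^ 2 / b) * ‖v‖ ^ 2)) := by
          refine norm_integral_le_of_norm_le
            (((integrable_rexp_neg_mul_sq_norm hb').const_mul _).const_mul _)
            (ae_of_all _ fun v ↦ ?_)
          rw [norm_mul, hgnorm]
          gcongr
          exact hM v
        _ = M := by
          rw [integral_const_mul, integral_const_mul,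
            GaussianFourier.integral_rexp_neg_mul_sq_norm hb',
            ← Real.mul_rpow (by positivity) (by positivity)]
          have : Real.pi / b * (Real.pi / (Real.pi ^ 2 / b)) = 1 := by field_simp
          rw [this, Real.one_rpow, mul_one]
    · refine hprod.congr (ae_of_all _ fun w ↦ ?_)
      simp [mul_comm]
  refine ⟨hcont.aestronglyMeasurable, ?_⟩
  have hlim (w : V) : Tendsto (fun n : ℕ ↦ ‖Real.exp (-((n : ℝ) + 1)⁻¹ * ‖w‖ ^ 2) • 𝓕 f w‖ₑ) atTop
      (𝓝 ‖𝓕 f w‖ₑ) := by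
    have h := (((tendsto_one_div_add_atTop_nhds_zero_nat (𝕜 := ℝ)).neg.mul_const (‖w‖ ^ 2)).rexp
      |>.smul_const (𝓕 f w)).enorm
    simpa using h
  calc ∫⁻ w, ‖𝓕 f w‖ₑ
    _ = ∫⁻ w, liminf (fun n : ℕ ↦ ‖Real.exp (-((n : ℝ) + 1)⁻¹ * ‖w‖ ^ 2) • 𝓕 f w‖ₑ) atTop := by
      simp_rw [(hlim _).liminf_eq]
    _ ≤ liminf (fun n : ℕ ↦ ∫⁻ w, ‖Real.exp (-((n : ℝ) + 1)⁻¹ * ‖w‖ ^ 2) • 𝓕 f w‖ₑ) atTop :=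
      lintegral_liminf_le fun n ↦ Continuous.measurable (by fun_prop)
    _ ≤ liminf (fun _ : ℕ ↦ ENNReal.ofReal M) atTop :=
      liminf_le_liminf (.of_forall fun n ↦ key (by positivity))
    _ < ⊤ := by simp

/-- A bounded continuous integrable function with nonnegative Fourier transform is the
characteristic function of a finite measure. -/
lemma exists_charFun_eq_of_fourier_nonneg {f : V → ℂ} (hf : Continuous f) (hint : Integrable f)
    {M : ℝ} (hM : ∀ v, ‖f v‖ ≤ M) (hpos : ∀ w, 0 ≤ 𝓕 f w) :
    ∃ μ : Measure V, IsFiniteMeasure μ ∧ ∀ t, charFun μ t = f t := by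
  have hFint := integrable_fourier_of_nonneg hint hM hpos
  have hcont : Continuous (𝓕 f) :=
    VectorFourier.fourierIntegral_continuous (L := innerₗ V) Real.continuous_fourierChar
      continuous_inner hint
  have hmeas : Measurable fun w ↦ ENNReal.ofReal (𝓕 f w).re :=
    (Complex.continuous_re.comp hcont).measurable.ennreal_ofReal
  let μ : Measure V := volume.withDensity fun w ↦ ENNReal.ofReal (𝓕 f w).re
  have : IsFiniteMeasure μ := isFiniteMeasure_withDensity_ofReal hFint.re.2
  refine ⟨μ.map fun w ↦ (2 * Real.pi) • w, inferInstance, fun t ↦ ?_⟩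
  rw [charFun_map_smul, charFun_apply, integral_withDensity_eq_integral_toReal_smul hmeas (by simp)]
  conv_rhs => rw [← hf.fourierInv_fourier_eq hint hFint, Real.fourierInv_eq']
  congr 1 with w
  have hre : ((𝓕 f w).re : ℂ) = 𝓕 f w := (Complex.eq_re_of_ofReal_le (hpos w)).symm
  rw [ENNReal.toReal_ofReal (Complex.nonneg_iff.1 (hpos w)).1, Complex.real_smul, hre,
    inner_smul_right, smul_eq_mul, mul_comm]

/-- A pointwise limit of characteristic functions of probability measures which is continuous at
`0` is a characteristic function. -/
lemma exists_charFun_eq_of_tendsto {μ : ℕ → ProbabilityMeasure V} {f : V → ℂ}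
    (hf : ContinuousAt f 0)
    (h : ∀ t, Tendsto (fun n ↦ charFun (μ n : Measure V) t) atTop (𝓝 (f t))) :
    ∃ ν : ProbabilityMeasure V, ∀ t, charFun (ν : Measure V) t = f t := by
  have htight := isTightMeasureSet_of_tendsto_charFun hf h
  have hcomp : IsCompact (closure (Set.range μ)) :=
    isCompact_closure_of_isTightMeasureSet (by simpa [Set.range, eq_comm] using htight)
  obtain ⟨ν, -, hν⟩ := hcomp.ultrafilter_le_nhds ((hyperfilter ℕ).map μ)
    (.trans (by simp) (Filter.monotone_principal subset_closure))
  have hν : Tendsto μ (hyperfilter ℕ) (𝓝 ν) := hν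
  refine ⟨ν, fun t ↦ tendsto_nhds_unique ?_ ((h t).mono_left Nat.hyperfilter_le_atTop)⟩
  rw [ProbabilityMeasure.tendsto_iff_forall_integral_rclike_tendsto ℂ] at hν
  simp_rw [charFun_eq_integral_innerProbChar]
  exact hν _

/-- **Bochner's theorem** for functions normalized at `0`. -/
lemma PosDefFun.exists_charFun_eq_of_zero_eq_one {k : V → ℂ} (hk : PosDefFun k)
    (hcont : Continuous k) (h0 : k 0 = 1) :
    ∃ ν : ProbabilityMeasure V, ∀ t, charFun (ν : Measure V) t = k t := by
  have happrox (n : ℕ) : ∃ μ : ProbabilityMeasure V, ∀ t, charFun (μ : Measure V) t =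
      Real.exp (-((n : ℝ) + 1)⁻¹ * ‖t‖ ^ 2) • k t := by
    have hb : 0 < ((n : ℝ) + 1)⁻¹ := by positivity
    have hk1 v : ‖k v‖ ≤ 1 := by simpa [h0] using hk.norm_le v
    obtain ⟨μ, hμ, hμk⟩ := exists_charFun_eq_of_fourier_nonneg
      (f := fun v ↦ Real.exp (-((n : ℝ) + 1)⁻¹ * ‖v‖ ^ 2) • k v) (M := 1) (by fun_prop)
      ((integrable_rexp_neg_mul_sq_norm hb).smul_bdd 1 hcont.aestronglyMeasurable
        (ae_of_all _ hk1))
      (fun v ↦ by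
        rw [norm_smul, Real.norm_eq_abs, Real.abs_exp]
        refine mul_le_one₀ (Real.exp_le_one_iff.2 ?_) (norm_nonneg _) (hk1 v)
        rw [neg_mul, neg_nonpos]
        positivity)
      (hk.fourier_gaussian_smul_nonneg hcont hb)
    have : IsProbabilityMeasure μ := by
      have := hμk 0
      rw [charFun_zero] at this
      exact ⟨by simpa [h0, Measure.real, ENNReal.toReal_eq_one_iff] using this⟩
    exact ⟨⟨μ, this⟩, hμk⟩
  choose μ hμ using happrox
  refine exists_charFun_eq_of_tendsto (μ := μ) hcont.continuousAt fun t ↦ ?_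
  simp_rw [hμ]
  have h := ((tendsto_one_div_add_atTop_nhds_zero_nat (𝕜 := ℝ)).neg.mul_const (‖t‖ ^ 2)).rexp
      |>.smul_const (k t)
  simpa using h

/-- **Bochner's theorem**: a continuous positive definite function on a finite-dimensional real
inner product space is the characteristic function of a finite measure. -/
theorem PosDefFun.exists_charFun_eq {k : V → ℂ} (hk : PosDefFun k) (hcont : Continuous k) :
    ∃ μ : Measure V, IsFiniteMeasure μ ∧ ∀ t, charFun μ t = k t := by
  obtain ⟨hre, him⟩ := Complex.nonneg_iff.1 hk.zero_nonneg
  have hk0 : k 0 = ((k 0).re : ℂ) := Complex.ext (by simp) (by simp [← him])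
  rcases hre.eq_or_lt with h | h
  · refine ⟨0, inferInstance, fun t ↦ ?_⟩
    have := hk.norm_le t
    rw [← h, norm_le_zero_iff] at this
    simp [this]
  · have hpd : PosDefFun fun v ↦ ((k 0).re : ℂ)⁻¹ * k v := fun n x c ↦ by
      have := mul_nonneg (Complex.zero_le_real.2 (inv_pos.2 h).le) (hk n x c)
      simpa [Finset.mul_sum, mul_left_comm] using this
    obtain ⟨ν, hν⟩ := hpd.exists_charFun_eq_of_zero_eq_one (by fun_prop)
      (by rw [hk0, Complex.ofReal_re, inv_mul_cancel₀ (by exact_mod_cast h.ne')])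
    refine ⟨ENNReal.ofReal (k 0).re • (ν : Measure V),
      Measure.smul_finite _ ENNReal.ofReal_ne_top, fun t ↦ ?_⟩
    have := hν t
    rw [charFun_apply] at this
    rw [charFun_apply, integral_smul_measure, this, ENNReal.toReal_ofReal hre, Complex.real_smul,
      mul_inv_cancel_left₀ (by exact_mod_cast h.ne')]

end InnerProductSpace

end Bochner

/-- Bochner's theorem, existence direction: a continuous positive-definite
function `k : ℝ^d → ℂ` is the inverse Fourier transform of a finite positive Borel
measure `μ` (its spectral measure), i.e. `k x = ∫ exp(i⟨ω, x⟩) dμ(ω)`, and in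
particular `k 0 = μ(ℝ^d)`. -/
theorem bochner_theorem_existence
    {d : ℕ} (k : EuclideanSpace ℝ (Fin d) → ℂ)
    (hcont : Continuous k)
    (hposdef : ∀ (n : ℕ) (x : Fin n → EuclideanSpace ℝ (Fin d)) (c : Fin n → ℂ),
      (∑ i : Fin n, ∑ j : Fin n, c i * (starRingEnd ℂ) (c j) * k (x i - x j)).im = 0 ∧
      0 ≤ (∑ i : Fin n, ∑ j : Fin n, c i * (starRingEnd ℂ) (c j) * k (x i - x j)).re) :
    ∃ μ : Measure (EuclideanSpace ℝ (Fin d)), IsFiniteMeasure μ ∧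
      (∀ x : EuclideanSpace ℝ (Fin d),
        k x = ∫ ω, Complex.exp (Complex.I * (⟪ω, x⟫ : ℝ)) ∂μ) ∧
      k 0 = ((μ Set.univ).toReal : ℂ) := by
  obtain ⟨μ, hμ, hμk⟩ := Bochner.PosDefFun.exists_charFun_eq (k := k)
    (fun n x c ↦ Complex.nonneg_iff.2 ⟨(hposdef n x c).2, (hposdef n x c).1.symm⟩) hcont
  refine ⟨μ, hμ, fun x ↦ ?_, ?_⟩
  · simp_rw [← hμk x, charFun_apply, mul_comm]
  · rw [← hμk 0, charFun_zero, Measure.real]
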